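/- Let λ > 0, let k ≥ 1 be an integer and let p be an integer with 0 ≤ p ≤ k−1. Let (p_n)_{n≥0} be an orthogonal polynomial sequence for w⁻ with normalized squared norms h_n. Then for all t ∈ [−1,1] and 0 ≤ r < 1 the series converges and Σ_{n=0}^∞ (p_n(t) p_n(cos(pπ/k))/h_n) r^n = (1−r²)(1 − 2r cos(pπ/k) t + r²) / [ ( (1 − 2r cos(pπ/k) t + r²)² − 4r² sin²(pπ/k)(1−t²) ) (1 − 2(−1)^p r^k T_k(t) + r^{2k})^λ ]. -/

import Mathlib

open Real MeasureTheory Polynomial Finset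

noncomputable section

def chebT (n : ℤ) (t : ℝ) : ℝ := (Polynomial.Chebyshev.T ℝ n).eval t
def chebU (n : ℤ) (t : ℝ) : ℝ := (Polynomial.Chebyshev.U ℝ n).eval t

/-- `w⁻(t) = |U_{k−1}(t)|^{2λ}(1−t²)^{λ−1/2}`. -/
def wminus (lam : ℝ) (k : ℕ) (t : ℝ) : ℝ :=
  |chebU ((k : ℤ) - 1) t| ^ (2 * lam) * (1 - t ^ 2) ^ (lam - 1 / 2)

/-- `(p_n)` is an orthogonal polynomial sequence for the weight `w` on `(−1,1)`. -/
def IsOPS (w : ℝ → ℝ) (p : ℕ → Polynomial ℝ) : Prop :=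
  (∀ n : ℕ, (p n).degree = n) ∧
  ∀ n m : ℕ, n ≠ m → (∫ t in (-1 : ℝ)..1, (p n).eval t * (p m).eval t * w t) = 0

/-- normalized squared norm `h_n = (∫ p² w)/(∫ w)`. -/
def hnorm (w : ℝ → ℝ) (p : Polynomial ℝ) : ℝ :=
  (∫ t in (-1 : ℝ)..1, (p.eval t) ^ 2 * w t) / (∫ t in (-1 : ℝ)..1, w t)

/-- The coefficient `x (x + 1) ⋯ (x + n - 1) / n!` of `(1 - z)⁻ˣ`. -/
def risingBinom (x : ℝ) (n : ℕ) : ℝ := ∏ i ∈ range n, (x + i) / (i + 1)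

@[simp] lemma risingBinom_zero (x : ℝ) : risingBinom x 0 = 1 := by simp [risingBinom]

lemma risingBinom_succ (x : ℝ) (n : ℕ) :
    (n + 1) * risingBinom x (n + 1) = (x + n) * risingBinom x n := by
  have : (n + 1 : ℝ) ≠ 0 := by positivity
  rw [risingBinom, prod_range_succ, ← risingBinom]
  field_simp

lemma risingBinom_pos {x : ℝ} (hx : 0 < x) (n : ℕ) : 0 < risingBinom x n :=
  prod_pos fun i _ => by positivity

lemma mul_risingBinom_add_one (x : ℝ) (n : ℕ) :
    x * risingBinom (x + 1) n = (x + n) * risingBinom x n := by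
  induction n with
  | zero => simp
  | succ n ih =>
    have h : (n + 1 : ℝ) ≠ 0 := by positivity
    apply mul_left_cancel₀ h
    have h1 := risingBinom_succ (x + 1) n
    have h2 := risingBinom_succ x n
    push_cast
    linear_combination x * h1 + (x + 1 + n) * ih - (x + 1 + n) * h2

lemma risingBinom_eq_choose (x : ℝ) (n : ℕ) : risingBinom x n = Ring.choose (x + n - 1) n := by
  rw [Ring.choose_eq_smul, Polynomial.descPochhammer_smeval_eq_ascPochhammer,
    show x + n - 1 - n + 1 = x by ring, smul_eq_mul]
  induction n with
  | zero => simp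
  | succ n ih =>
    have h : (n + 1 : ℝ) ≠ 0 := by positivity
    have h' : (n.factorial : ℝ) ≠ 0 := by positivity
    apply mul_left_cancel₀ h
    rw [risingBinom_succ, ih, ascPochhammer_succ_right, Nat.factorial_succ]
    simp [Polynomial.smeval_mul, Polynomial.smeval_natCast]
    field_simp

/-- Coefficients of the circular Jacobi polynomials, orthogonal on the circle with respect to
`|1 - w| ^ (2 * lam)`. -/
def jacobiCoeff (lam : ℝ) (N a : ℕ) : ℝ := risingBinom (lam + 1) a * risingBinom lam (N - a)

section Algebra

variable {lam : ℝ}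

lemma jacobiCoeff_pos (hlam : 0 < lam) (N a : ℕ) : 0 < jacobiCoeff lam N a :=
  mul_pos (risingBinom_pos (by linarith) _) (risingBinom_pos hlam _)

lemma jacobiCoeff_succ (lam : ℝ) {N a : ℕ} (h : a < N) :
    (a + 1) * (lam + N - (a + 1)) * jacobiCoeff lam N (a + 1) =
      (N - a) * (lam + 1 + a) * jacobiCoeff lam N a := by
  obtain ⟨b, rfl⟩ := Nat.exists_eq_add_of_lt h
  have h1 := risingBinom_succ (lam + 1) a
  have h2 := risingBinom_succ lam b
  rw [jacobiCoeff, jacobiCoeff, show a + b + 1 - (a + 1) = b by omega,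
    show a + b + 1 - a = b + 1 by omega]
  push_cast
  linear_combination (lam + b) * risingBinom lam b * h1 -
    (lam + 1 + a) * risingBinom (lam + 1) a * h2

lemma sum_jacobiCoeff_shift (lam : ℝ) (N : ℕ) (f : ℤ → ℝ) :
    ∑ a ∈ range (N + 1), a * (lam + N - a) * jacobiCoeff lam N a * f a =
      ∑ a ∈ range (N + 1), (N - a) * (lam + 1 + a) * jacobiCoeff lam N a * f (a + 1) := by
  rw [sum_range_succ', sum_range_succ]
  simp only [Nat.cast_zero, zero_mul, add_zero, sub_self]
  refine sum_congr rfl fun a ha => ?_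
  push_cast
  rw [jacobiCoeff_succ lam (mem_range.1 ha)]

lemma sum_jacobiCoeff_step {c : ℤ → ℝ}
    (hc : ∀ x : ℤ, (x + 1 + lam) * c (x + 1) = (x - lam) * c x) (N : ℕ) (l : ℤ) :
    (N - l) * (l + lam) * ∑ a ∈ range (N + 1), jacobiCoeff lam N a * c (a - l) =
      l * (lam + 1 + N - l) * ∑ a ∈ range (N + 1), jacobiCoeff lam N a * c (a - (l - 1)) := by
  have hs := sum_jacobiCoeff_shift lam N (fun x => c (x - l))
  rw [← sub_eq_zero, ← sum_sub_distrib] at hs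
  rw [← sub_eq_zero, mul_sum, mul_sum, ← sum_sub_distrib, ← hs]
  refine sum_congr rfl fun a _ => ?_
  have h := hc (a - l)
  rw [show (a : ℤ) - l + 1 = a - (l - 1) by ring] at h
  rw [show (a : ℤ) + 1 - l = a - (l - 1) by ring]
  push_cast at h
  linear_combination (-(a - N + l : ℝ)) * jacobiCoeff lam N a * h

/-- Orthogonality of the circular Jacobi polynomials, from the two-term recurrence for the
moments. -/
lemma sum_jacobiCoeff_eq_zero (hlam : 0 < lam) {c : ℤ → ℝ}
    (hc : ∀ x : ℤ, (x + 1 + lam) * c (x + 1) = (x - lam) * c x) {N : ℕ} (l : ℕ) (hl : l < N) :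
    ∑ a ∈ range (N + 1), jacobiCoeff lam N a * c (a - l) = 0 := by
  induction l with
  | zero =>
    have h := sum_jacobiCoeff_step hc N 0
    have hN : (N : ℝ) ≠ 0 := by positivity
    simpa [hN, hlam.ne'] using h
  | succ l ih =>
    have h := sum_jacobiCoeff_step hc N (l + 1)
    rw [show ((l : ℤ) + 1 - 1) = l by ring, ih (by omega), mul_zero] at h
    have h1 : (N : ℝ) - (l + 1) ≠ 0 := by
      have : ((l + 1 : ℕ) : ℝ) < N := by exact_mod_cast hl
      push_cast at this
      linarith
    have h2 : (l + 1 : ℝ) + lam ≠ 0 := by positivity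
    simpa [h1, h2] using h

lemma sum_jacobiCoeff_three_term (lam : ℝ) (N : ℕ) (f : ℤ → ℝ) :
    (N + 2) * ∑ a ∈ range (N + 3), jacobiCoeff lam (N + 2) a * f a =
      (N + 2 + lam) * ∑ a ∈ range (N + 2), jacobiCoeff lam (N + 1) a * f (a + 1) +
      (N + 1 + lam) * ∑ a ∈ range (N + 2), jacobiCoeff lam (N + 1) a * f a -
      (N + 1 + 2 * lam) * ∑ a ∈ range (N + 1), jacobiCoeff lam N a * f (a + 1) := by
  rw [sum_range_succ' _ (N + 2), sum_range_succ _ (N + 1),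
    sum_range_succ' (fun a : ℕ => jacobiCoeff lam (N + 1) a * f a) (N + 1),
    sum_range_succ (fun a : ℕ => jacobiCoeff lam (N + 1) a * f (a + 1)) (N + 1)]
  have h0 : (N + 2) * jacobiCoeff lam (N + 2) 0 = (N + 1 + lam) * jacobiCoeff lam (N + 1) 0 := by
    have := risingBinom_succ lam (N + 1)
    simp only [jacobiCoeff, risingBinom_zero, one_mul, Nat.sub_zero]
    push_cast at this
    linear_combination this
  have hN : (N + 2) * jacobiCoeff lam (N + 2) (N + 2) =
      (N + 2 + lam) * jacobiCoeff lam (N + 1) (N + 1) := by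
    have := risingBinom_succ (lam + 1) (N + 1)
    simp only [jacobiCoeff, risingBinom_zero, mul_one, Nat.sub_self]
    push_cast at this
    linear_combination this
  have hm : (N + 2) * ∑ a ∈ range (N + 1), jacobiCoeff lam (N + 2) (a + 1) * f (a + 1) =
      (N + 2 + lam) * ∑ a ∈ range (N + 1), jacobiCoeff lam (N + 1) a * f (a + 1) +
      (N + 1 + lam) * ∑ a ∈ range (N + 1), jacobiCoeff lam (N + 1) (a + 1) * f (a + 1) -
      (N + 1 + 2 * lam) * ∑ a ∈ range (N + 1), jacobiCoeff lam N a * f (a + 1) := by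
    simp only [mul_sum, ← sum_add_distrib, ← sum_sub_distrib]
    refine sum_congr rfl fun a ha => ?_
    obtain ⟨b, rfl⟩ := Nat.exists_eq_add_of_le (Nat.lt_succ_iff.1 (mem_range.1 ha))
    have h1 := risingBinom_succ (lam + 1) a
    have h2 := risingBinom_succ lam b
    have h3 : (a + 1 : ℝ) ≠ 0 := by positivity
    have h4 : (b + 1 : ℝ) ≠ 0 := by positivity
    rw [mul_comm, ← eq_div_iff h3] at h1
    rw [mul_comm, ← eq_div_iff h4] at h2
    simp only [jacobiCoeff]
    rw [show a + b + 2 - (a + 1) = b + 1 by omega, show a + b + 1 - a = b + 1 by omega,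
      show a + b + 1 - (a + 1) = b by omega, show a + b - a = b by omega, h1, h2]
    push_cast
    field_simp
    ring
  push_cast at *
  linear_combination hm + f 0 * h0 + f (N + 1 + 1) * hN

lemma sum_jacobiCoeff_top (hlam : 0 < lam) {c : ℤ → ℝ}
    (hc : ∀ x : ℤ, (x + 1 + lam) * c (x + 1) = (x - lam) * c x) (N : ℕ) :
    (N + 1 + lam) * ∑ a ∈ range (N + 2), jacobiCoeff lam (N + 1) a * c (a - (N + 1)) =
      (N + 1 + 2 * lam) * ∑ a ∈ range (N + 1), jacobiCoeff lam N a * c (a - N) := by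
  have h := sum_jacobiCoeff_three_term lam N (fun x => c (x - (N + 1)))
  have h1 := sum_jacobiCoeff_eq_zero hlam hc (N := N + 2) (N + 1) (by omega)
  have h2 := sum_jacobiCoeff_eq_zero hlam hc (N := N + 1) N (by omega)
  push_cast at h1 h2
  rw [h1] at h
  simp only [show ∀ a : ℕ, (a : ℤ) + 1 - (N + 1) = a - N by intro a; ring, h2] at h
  linear_combination -h

lemma sum_jacobiCoeff_one (lam : ℝ) (N : ℕ) :
    (N + 1) * ∑ a ∈ range (N + 2), jacobiCoeff lam (N + 1) a =
      (N + 1 + 2 * lam) * ∑ a ∈ range (N + 1), jacobiCoeff lam N a := by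
  induction N with
  | zero =>
    have h1 := risingBinom_succ lam 0
    have h2 := risingBinom_succ (lam + 1) 0
    simp at h1 h2
    simp [sum_range_succ, jacobiCoeff, h1, h2]
    ring
  | succ N ih =>
    have h := sum_jacobiCoeff_three_term lam N (fun _ => 1)
    simp only [mul_one] at h
    push_cast
    linear_combination h + ih

/-- The squared norm of the circular Jacobi polynomial. -/
lemma jacobiCoeff_mul_sum_top (hlam : 0 < lam) {c : ℤ → ℝ}
    (hc : ∀ x : ℤ, (x + 1 + lam) * c (x + 1) = (x - lam) * c x) (N : ℕ) :
    jacobiCoeff lam N N * ∑ a ∈ range (N + 1), jacobiCoeff lam N a * c (a - N) =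
      c 0 * ∑ a ∈ range (N + 1), jacobiCoeff lam N a := by
  induction N with
  | zero => simp [jacobiCoeff]
  | succ N ih =>
    have h1 := sum_jacobiCoeff_top hlam hc N
    have h2 := sum_jacobiCoeff_one lam N
    have h3 : (N + 1) * jacobiCoeff lam (N + 1) (N + 1) =
        (N + 1 + lam) * jacobiCoeff lam N N := by
      have := risingBinom_succ (lam + 1) N
      simp only [jacobiCoeff, risingBinom_zero, mul_one, Nat.sub_self]
      linear_combination this
    have h4 : (N + 1 : ℝ) ≠ 0 := by positivity
    apply mul_left_cancel₀ h4
    push_cast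
    rw [← mul_assoc, h3]
    linear_combination jacobiCoeff lam N N * h1 + (N + 1 + 2 * lam) * ih - c 0 * h2

end Algebra

section Moments

variable {lam : ℝ} {k : ℕ}

@[fun_prop]
lemma continuous_abs_sin_rpow (hlam : 0 < lam) (k : ℕ) :
    Continuous fun θ : ℝ => |sin (k * θ)| ^ (2 * lam) := by
  refine Continuous.rpow_const (by fun_prop) fun x => Or.inr (by positivity)

/-- Cosine moments of the weight `|sin kθ| ^ (2 * lam)`. -/
def sievedMoment (lam : ℝ) (k : ℕ) (q : ℤ) : ℝ :=
  ∫ θ in (0 : ℝ)..π, cos (q * θ) * |sin (k * θ)| ^ (2 * lam)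

lemma hasDerivAt_abs_rpow_mul_self {p : ℝ} (hp : 0 < p) (u : ℝ) :
    HasDerivAt (fun u : ℝ => |u| ^ p * u) ((p + 1) * |u| ^ p) u := by
  rcases eq_or_ne u 0 with rfl | hu
  · rw [hasDerivAt_iff_tendsto_slope]
    have hc : Continuous fun u : ℝ => |u| ^ p :=
      continuous_abs.rpow_const fun _ => Or.inr hp.le
    have h0 : (p + 1) * |(0 : ℝ)| ^ p = |(0 : ℝ)| ^ p := by simp [hp.ne']
    rw [h0]
    refine (hc.continuousAt.tendsto.mono_left nhdsWithin_le_nhds).congr' ?_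
    filter_upwards [self_mem_nhdsWithin] with x hx
    rw [slope_def_field]
    have : x ≠ 0 := hx
    field_simp
    simp
  · have h1 := (hasDerivAt_abs hu).rpow_const (p := p) (Or.inl (abs_ne_zero.2 hu))
    have h2 := h1.mul (hasDerivAt_id u)
    refine h2.congr_deriv ?_
    rw [rpow_sub_one (abs_ne_zero.2 hu)]
    have : (SignType.sign u : ℝ) * u = |u| := sign_mul_self u
    have h3 := abs_ne_zero.2 hu
    simp only [id]
    field_simp
    linear_combination p * this

lemma sievedMoment_recurrence (hlam : 0 < lam) (hk : k ≠ 0) (x : ℤ) :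
    (x + 1 + lam) * sievedMoment lam k (2 * k * (x + 1)) =
      (x - lam) * sievedMoment lam k (2 * k * x) := by
  have hk' : (k : ℝ) ≠ 0 := by exact_mod_cast hk
  have hd : ∀ θ : ℝ, HasDerivAt
      (fun θ : ℝ => cos ((2 * x + 1) * (k * θ)) * (|sin (k * θ)| ^ (2 * lam) * sin (k * θ)))
      (k * ((x + 1 + lam) * (cos ((2 * k * (x + 1) : ℤ) * θ) * |sin (k * θ)| ^ (2 * lam)) -
        (x - lam) * (cos ((2 * k * x : ℤ) * θ) * |sin (k * θ)| ^ (2 * lam)))) θ := by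
    intro θ
    have hkθ : HasDerivAt (fun θ : ℝ => k * θ) k θ := by
      simpa using (hasDerivAt_id θ).const_mul (k : ℝ)
    have h1 := ((hkθ.const_mul (2 * x + 1 : ℝ)).cos)
    have h2 := (hasDerivAt_abs_rpow_mul_self (p := 2 * lam) (by positivity) (sin (k * θ))).comp θ
      hkθ.sin
    refine (h1.mul h2).congr_deriv ?_
    have e1 : ((2 * k * (x + 1) : ℤ) : ℝ) * θ = (2 * x + 1) * (k * θ) + k * θ := by
      push_cast; ring
    have e2 : ((2 * k * x : ℤ) : ℝ) * θ = (2 * x + 1) * (k * θ) - k * θ := by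
      push_cast; ring
    rw [e1, e2, cos_add, cos_sub]
    simp only [Function.comp]
    ring
  have hi := intervalIntegral.integral_eq_sub_of_hasDerivAt (a := 0) (b := π)
    (fun θ _ => hd θ) (Continuous.intervalIntegrable (by fun_prop (disch := assumption)) _ _)
  simp only [sin_nat_mul_pi, mul_zero, sin_zero, sub_zero] at hi
  rw [intervalIntegral.integral_const_mul, intervalIntegral.integral_sub,
    intervalIntegral.integral_const_mul, intervalIntegral.integral_const_mul] at hi
  · exact sub_eq_zero.1 ((mul_eq_zero.1 hi).resolve_left hk')
  all_goals exact Continuous.intervalIntegrable (by fun_prop (disch := assumption)) _ _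

lemma sievedMoment_eq_zero (hlam : 0 < lam) (hk : k ≠ 0) {q : ℤ} (hq : ¬ (2 * k : ℤ) ∣ q) :
    sievedMoment lam k q = 0 := by
  have hk' : (k : ℝ) ≠ 0 := by exact_mod_cast hk
  set w : ℝ → ℝ := fun θ => |sin (k * θ)| ^ (2 * lam) with hw
  have hwc : Continuous w := continuous_abs_sin_rpow hlam k
  have hw_neg (θ : ℝ) : w (-θ) = w θ := by simp [hw]
  have hw_shift (θ : ℝ) : w (θ + π / k) = w θ := by
    simp only [hw]
    rw [show (k : ℝ) * (θ + π / k) = k * θ + π by field_simp, sin_add_pi, abs_neg]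
  have hw_per (θ : ℝ) : w (θ + 2 * π) = w θ := by
    simp only [hw]
    rw [show (k : ℝ) * (θ + 2 * π) = k * θ + k * (2 * π) by ring, sin_add_nat_mul_two_pi]
  have hi (g : ℝ → ℝ) (hg : Continuous g) (a b : ℝ) :
      IntervalIntegrable (fun θ => g θ * w θ) volume a b := (hg.mul hwc).intervalIntegrable _ _
  have hS : ∫ θ in (-π)..π, sin (q * θ) * w θ = 0 := by
    have h := intervalIntegral.integral_comp_neg (a := -π) (b := π) fun θ => sin (q * θ) * w θ
    simp only [hw_neg, mul_neg, sin_neg, neg_mul, neg_neg, intervalIntegral.integral_neg] at h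
    linarith
  have hC : ∫ θ in (-π)..π, cos (q * θ) * w θ = 2 * sievedMoment lam k q := by
    have h := intervalIntegral.integral_comp_neg (a := 0) (b := π) fun θ => cos (q * θ) * w θ
    simp only [hw_neg, mul_neg, cos_neg, neg_zero] at h
    rw [← intervalIntegral.integral_add_adjacent_intervals (hi _ (by fun_prop) _ 0)
      (hi _ (by fun_prop) _ _), ← h, sievedMoment]
    ring
  have hper : Function.Periodic (fun θ => cos (q * θ) * w θ) (2 * π) := by
    intro θ
    simp only [hw_per]
    rw [show (q : ℝ) * (θ + 2 * π) = q * θ + q * (2 * π) by ring, cos_add_int_mul_two_pi]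
  have hsh : ∫ θ in (-π)..π, cos (q * θ) * w θ =
      cos (q * (π / k)) * ∫ θ in (-π)..π, cos (q * θ) * w θ := by
    have h1 := hper.intervalIntegral_add_eq (-π) (-π + π / k)
    rw [show -π + 2 * π = π by ring, show -π + π / k + 2 * π = π + π / k by ring,
      ← intervalIntegral.integral_comp_add_right] at h1
    rw [h1]
    calc _ = ∫ θ in (-π)..π, (cos (q * (π / k)) * (cos (q * θ) * w θ) -
          sin (q * (π / k)) * (sin (q * θ) * w θ)) := by
          refine intervalIntegral.integral_congr fun θ _ => ?_
          simp only [hw_shift]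
          rw [mul_add, cos_add]
          ring
      _ = _ := by
        rw [intervalIntegral.integral_sub, intervalIntegral.integral_const_mul,
          intervalIntegral.integral_const_mul, hS, ← h1]
        · ring
        all_goals exact Continuous.intervalIntegrable (by fun_prop) _ _
  have hne : cos (q * (π / k)) ≠ 1 := by
    intro h
    obtain ⟨n, hn⟩ := (cos_eq_one_iff _).1 h
    apply hq
    refine ⟨n, ?_⟩
    have : (q : ℝ) = 2 * k * n := by
      field_simp at hn
      linarith
    exact_mod_cast this
  have : (1 - cos (q * (π / k))) * ∫ θ in (-π)..π, cos (q * θ) * w θ = 0 := by linarith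
  rcases mul_eq_zero.1 this with h | h
  · exact absurd (by linarith) hne
  · linarith

end Moments

section Functional

variable {lam : ℝ} {k : ℕ}

lemma integral_mul_wminus (lam : ℝ) (k : ℕ) (f : ℝ → ℝ) :
    ∫ t in (-1 : ℝ)..1, f t * wminus lam k t =
      ∫ θ in (0 : ℝ)..π, f (cos θ) * |sin (k * θ)| ^ (2 * lam) := by
  set g : ℝ → ℝ := fun t => f t * (|chebU ((k : ℤ) - 1) t| ^ (2 * lam) * (1 - t ^ 2) ^ lam) with hg
  have h1 : ∀ θ : ℝ, f (cos θ) * |sin (k * θ)| ^ (2 * lam) = g (cos θ) := by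
    intro θ
    have hU : chebU ((k : ℤ) - 1) (cos θ) * sin θ = sin (k * θ) := by
      have := Polynomial.Chebyshev.U_real_cos θ ((k : ℤ) - 1)
      push_cast at this
      rwa [sub_add_cancel] at this
    simp only [hg]
    rw [← hU, abs_mul, mul_rpow (abs_nonneg _) (abs_nonneg _), ← sin_sq, ← sq_abs (sin θ),
      ← rpow_natCast_mul (abs_nonneg _)]
    norm_cast
  simp only [h1]
  rw [← Polynomial.Chebyshev.integral_measureT_eq_integral_cos,
    Polynomial.Chebyshev.integral_measureT, intervalIntegral.integral_of_le (by norm_num),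
    intervalIntegral.integral_of_le (by norm_num), integral_Ioc_eq_integral_Ioo,
    integral_Ioc_eq_integral_Ioo]
  refine setIntegral_congr_fun measurableSet_Ioo fun t ht => ?_
  have ht' : 0 < 1 - t ^ 2 := by nlinarith [ht.1, ht.2]
  simp only [hg, wminus]
  rw [rpow_sub ht', ← sqrt_eq_rpow, sqrt_inv]
  ring

/-- Integration of a polynomial against `|sin kθ| ^ (2 * lam)` in the variable `cos θ`. -/
def sievedFunctional (hlam : 0 < lam) (k : ℕ) : ℝ[X] →ₗ[ℝ] ℝ where
  toFun f := ∫ θ in (0 : ℝ)..π, f.eval (cos θ) * |sin (k * θ)| ^ (2 * lam)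
  map_add' f g := by
    simp only [eval_add, add_mul]
    refine intervalIntegral.integral_add ?_ ?_ <;>
      exact Continuous.intervalIntegrable (by fun_prop (disch := assumption)) _ _
  map_smul' c f := by
    simp [mul_assoc, intervalIntegral.integral_const_mul]

lemma sievedFunctional_apply (hlam : 0 < lam) (k : ℕ) (f : ℝ[X]) :
    sievedFunctional hlam k f = ∫ t in (-1 : ℝ)..1, f.eval t * wminus lam k t :=
  (integral_mul_wminus lam k fun t => f.eval t).symm

lemma sievedFunctional_T (hlam : 0 < lam) (k : ℕ) (m : ℤ) :
    sievedFunctional hlam k (Chebyshev.T ℝ m) = sievedMoment lam k m := by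
  simp [sievedFunctional, sievedMoment, Polynomial.Chebyshev.T_real_cos]

lemma sievedFunctional_T_mul_T (hlam : 0 < lam) (k : ℕ) (m j : ℤ) :
    sievedFunctional hlam k (Chebyshev.T ℝ m * Chebyshev.T ℝ j) =
      (sievedMoment lam k (m + j) + sievedMoment lam k (m - j)) / 2 := by
  have h := congrArg (sievedFunctional hlam k) (Polynomial.Chebyshev.T_mul_T ℝ m j)
  rw [map_add, sievedFunctional_T, sievedFunctional_T, mul_assoc, ← C_ofNat, ← smul_eq_C_mul,
    map_smul, smul_eq_mul] at h
  linarith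

lemma sievedFunctional_mul_self_pos (hlam : 0 < lam) (hk : k ≠ 0) {f : ℝ[X]} (hf : f ≠ 0) :
    0 < sievedFunctional hlam k (f * f) := by
  refine intervalIntegral.integral_pos pi_pos
    (Continuous.continuousOn (by fun_prop (disch := assumption))) ?_ ?_
  · intro θ _
    rw [eval_mul]
    exact mul_nonneg (mul_self_nonneg _) (rpow_nonneg (abs_nonneg _) _)
  · have hU : Chebyshev.U ℝ ((k : ℤ) - 1) ≠ 0 := by
      intro h
      have := Polynomial.Chebyshev.degree_U_of_ne_neg_one (R := ℝ) ((k : ℤ) - 1) (by omega)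
      rw [h] at this
      simp at this
    obtain ⟨t, ht, hne⟩ : ∃ t ∈ Set.Ioo (-1 : ℝ) 1,
        (f * Chebyshev.U ℝ ((k : ℤ) - 1)).eval t ≠ 0 := by
      by_contra! h
      exact mul_ne_zero hf hU (eq_zero_of_infinite_isRoot _
        ((Set.Ioo_infinite (by norm_num : (-1 : ℝ) < 1)).mono fun t ht => h t ht))
    rw [eval_mul] at hne
    refine ⟨arccos t, ⟨arccos_nonneg t, arccos_le_pi t⟩, ?_⟩
    rw [cos_arccos ht.1.le ht.2.le, eval_mul]
    have h1 := left_ne_zero_of_mul hne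
    have h2 := right_ne_zero_of_mul hne
    have h3 : sin (k * arccos t) ≠ 0 := by
      have := Polynomial.Chebyshev.U_real_cos (arccos t) ((k : ℤ) - 1)
      push_cast at this
      rw [sub_add_cancel, cos_arccos ht.1.le ht.2.le] at this
      rw [← this]
      refine mul_ne_zero h2 ?_
      rw [sin_arccos]
      exact (sqrt_pos.2 (by nlinarith [ht.1, ht.2])).ne'
    exact mul_pos (mul_self_pos.2 h1) (rpow_pos_of_pos (abs_pos.2 h3) _)

end Functional

lemma exists_degree_sub_smul_lt {p f : ℝ[X]} {n : ℕ} (hp : p.degree = n)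
    (hf : f.degree ≤ n) : ∃ c : ℝ, (f - c • p).degree < n := by
  have hpn : p.coeff n ≠ 0 := by
    intro h
    have h0 : p ≠ 0 := fun h0 => by simp [h0] at hp
    exact h0 (leadingCoeff_eq_zero.1 (by
      rwa [leadingCoeff, natDegree_eq_of_degree_eq_some hp]))
  refine ⟨f.coeff n / p.coeff n, (degree_lt_iff_coeff_zero _ _).2 fun m hm => ?_⟩
  rcases hm.eq_or_lt with rfl | hm
  · simp [hpn]
  · have h1 : f.coeff m = 0 := coeff_eq_zero_of_degree_lt (hf.trans_lt (by exact_mod_cast hm))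
    have h2 : p.coeff m = 0 := coeff_eq_zero_of_degree_lt (by rw [hp]; exact_mod_cast hm)
    simp [h1, h2]

/-- A linear functional vanishing on the first `n` members of a polynomial sequence vanishes on
all polynomials of degree less than `n`. -/
lemma linearMap_eq_zero_of_degree_lt {p : ℕ → ℝ[X]} (hp : ∀ n, (p n).degree = n)
    (L : ℝ[X] →ₗ[ℝ] ℝ) {n : ℕ} (hL : ∀ m < n, L (p m) = 0) {f : ℝ[X]} (hf : f.degree < n) :
    L f = 0 := by
  induction n generalizing f with
  | zero => simp_all
  | succ n ih =>
    have hf' : f.degree ≤ n := by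
      rw [degree_le_iff_coeff_zero]
      intro m hm
      exact (degree_lt_iff_coeff_zero _ _).1 hf m (Nat.succ_le_of_lt (by exact_mod_cast hm))
    obtain ⟨c, hc⟩ := exists_degree_sub_smul_lt (hp n) hf'
    have := ih (fun m hm => hL m (by omega)) hc
    rwa [map_sub, map_smul, hL n (by omega), smul_zero, sub_zero] at this

section Sieved

variable {lam : ℝ} {k : ℕ}

/-- The sieved Gegenbauer polynomial of degree `k * N + s`, up to normalization. -/
def sievedPoly (lam : ℝ) (k N s : ℕ) : ℝ[X] :=
  ∑ a ∈ range (N + 1), jacobiCoeff lam N a • Chebyshev.T ℝ (s + k * (2 * a - N))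

/-- The value of `sievedPoly lam k N s` at `1`. -/
def sievedValue (lam : ℝ) (N : ℕ) : ℝ := ∑ a ∈ range (N + 1), jacobiCoeff lam N a

/-- The factor relating the squared norm of `sievedPoly lam k N s` to its value at `1`. -/
def sievedWeight (lam : ℝ) (N s : ℕ) : ℝ := if s = 0 then 2 * (lam + N) / (2 * lam + N) else 2

lemma sievedValue_pos (hlam : 0 < lam) (N : ℕ) : 0 < sievedValue lam N :=
  sum_pos (fun a _ => jacobiCoeff_pos hlam N a) (by simp)

lemma eval_cos_sievedPoly (lam : ℝ) (k N s : ℕ) (θ : ℝ) :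
    (sievedPoly lam k N s).eval (cos θ) =
      ∑ a ∈ range (N + 1), jacobiCoeff lam N a * cos ((s + k * (2 * a - N)) * θ) := by
  simp [sievedPoly, eval_finsetSum, Polynomial.Chebyshev.T_real_cos]

lemma eval_one_sievedPoly (lam : ℝ) (k N s : ℕ) :
    (sievedPoly lam k N s).eval 1 = sievedValue lam N := by
  simpa [sievedValue] using eval_cos_sievedPoly lam k N s 0

lemma degree_sievedPoly_le (lam : ℝ) (k N s : ℕ) :
    (sievedPoly lam k N s).degree ≤ (k * N + s : ℕ) := by
  refine (degree_sum_le _ _).trans (Finset.sup_le fun a ha => (degree_smul_le _ _).trans ?_)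
  rw [Polynomial.Chebyshev.degree_T]
  have ha : (a : ℤ) ≤ N := by exact_mod_cast Nat.lt_succ_iff.1 (mem_range.1 ha)
  have h1 : (k * (2 * a - N) : ℤ) ≤ k * N := by gcongr; omega
  have h2 : (-(k * N) : ℤ) ≤ k * (2 * a - N) := by
    rw [← mul_neg]; gcongr; omega
  have : (s + k * (2 * a - N) : ℤ).natAbs ≤ k * N + s := by
    zify
    rw [abs_le]
    constructor <;> linarith
  exact_mod_cast this

lemma sum_jacobiCoeff_mul_sievedMoment_eq_zero (hlam : 0 < lam) (hk : k ≠ 0) {N s : ℕ}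
    (hs : s < k) {j : ℤ} (hj : -(k * N + s : ℤ) < j) (hj' : j ≤ k * N + s) :
    ∑ a ∈ range (N + 1), jacobiCoeff lam N a * sievedMoment lam k (s + k * (2 * a - N) + j) =
      0 := by
  by_cases h : (2 * k : ℤ) ∣ k * N - s - j
  · obtain ⟨l, hl⟩ := h
    have hk0 : (0 : ℤ) < k := by exact_mod_cast Nat.pos_of_ne_zero hk
    have hs' : (s : ℤ) < k := by exact_mod_cast hs
    have hl0 : 0 ≤ l := by
      by_contra! hl0
      have : 2 * k * l ≤ 2 * k * (-1 : ℤ) := by gcongr; omega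
      linarith
    have hlN : l < N := by
      by_contra! hlN
      have : 2 * k * (N : ℤ) ≤ 2 * k * l := by gcongr
      linarith
    lift l to ℕ using hl0
    rw [← sum_jacobiCoeff_eq_zero hlam (c := fun x => sievedMoment lam k (2 * k * x))
      (sievedMoment_recurrence hlam hk) l (by exact_mod_cast hlN)]
    refine sum_congr rfl fun a _ => ?_
    congr 2
    linarith
  · refine sum_eq_zero fun a _ => ?_
    rw [sievedMoment_eq_zero hlam hk, mul_zero]
    intro h'
    apply h
    rw [show (k * N - s - j : ℤ) = 2 * k * a - (s + k * (2 * a - N) + j) by ring]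
    exact (dvd_mul_right _ _).sub h'

lemma sievedFunctional_sievedPoly_mul_T (hlam : 0 < lam) (k N s : ℕ) (j : ℤ) :
    sievedFunctional hlam k (sievedPoly lam k N s * Chebyshev.T ℝ j) =
      (∑ a ∈ range (N + 1), jacobiCoeff lam N a * sievedMoment lam k (s + k * (2 * a - N) + j) +
        ∑ a ∈ range (N + 1),
          jacobiCoeff lam N a * sievedMoment lam k (s + k * (2 * a - N) + -j)) / 2 := by
  rw [sievedPoly, sum_mul, map_sum, ← sum_add_distrib, sum_div]
  refine sum_congr rfl fun a _ => ?_
  rw [smul_mul_assoc, map_smul, sievedFunctional_T_mul_T, smul_eq_mul, ← sub_eq_add_neg]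
  ring

lemma sievedFunctional_sievedPoly_mul_T_eq_zero (hlam : 0 < lam) (hk : k ≠ 0) {N s : ℕ}
    (hs : s < k) {j : ℤ} (hj : |j| < k * N + s) :
    sievedFunctional hlam k (sievedPoly lam k N s * Chebyshev.T ℝ j) = 0 := by
  obtain ⟨h1, h2⟩ := abs_lt.1 hj
  rw [sievedFunctional_sievedPoly_mul_T,
    sum_jacobiCoeff_mul_sievedMoment_eq_zero hlam hk hs h1 h2.le,
    sum_jacobiCoeff_mul_sievedMoment_eq_zero hlam hk hs (by linarith) (by linarith)]
  simp

lemma jacobiCoeff_mul_sievedFunctional_sievedPoly_mul_T (hlam : 0 < lam) (hk : k ≠ 0) {N s : ℕ}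
    (hs : s < k) (hn : 0 < k * N + s) :
    jacobiCoeff lam N N *
        sievedFunctional hlam k (sievedPoly lam k N s * Chebyshev.T ℝ (k * N + s)) =
      sievedMoment lam k 0 * sievedValue lam N / 2 := by
  have hn' : (0 : ℤ) < k * N + s := by exact_mod_cast hn
  rw [sievedFunctional_sievedPoly_mul_T,
    sum_jacobiCoeff_mul_sievedMoment_eq_zero hlam hk hs (by linarith) le_rfl, zero_add]
  have h := jacobiCoeff_mul_sum_top hlam (c := fun x => sievedMoment lam k (2 * k * x))
      (sievedMoment_recurrence hlam hk) N
  rw [mul_zero, ← sievedValue] at h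
  rw [← h, mul_div_assoc]
  congr 2
  refine sum_congr rfl fun a _ => ?_
  congr 2
  ring

lemma sievedFunctional_sievedPoly_mul_self (hlam : 0 < lam) (hk : k ≠ 0) {N s : ℕ}
    (hs : s < k) :
    sievedWeight lam N s * sievedFunctional hlam k (sievedPoly lam k N s * sievedPoly lam k N s) =
      sievedMoment lam k 0 * sievedValue lam N := by
  have hk0 : (0 : ℤ) < k := by exact_mod_cast Nat.pos_of_ne_zero hk
  rcases Nat.eq_zero_or_pos (k * N + s) with hn | hn
  · obtain ⟨hN, rfl⟩ := Nat.add_eq_zero_iff.1 hn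
    obtain rfl : N = 0 := by simpa [hk] using hN
    have := sievedFunctional_T hlam k 0
    have hl : 2 * lam ≠ 0 := by positivity
    simp_all [sievedWeight, sievedPoly, sievedValue, jacobiCoeff]
  have htop := jacobiCoeff_mul_sievedFunctional_sievedPoly_mul_T hlam hk hs hn
  set L := sievedFunctional hlam k with hL
  set g := sievedPoly lam k N s with hg
  have hsum : L (g * g) = ∑ b ∈ range (N + 1), jacobiCoeff lam N b *
      L (g * Chebyshev.T ℝ (s + k * (2 * b - N))) := by
    nth_rw 2 [hg]
    rw [sievedPoly, mul_sum, map_sum]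
    simp
  have hzero : ∀ b ∈ range N, (s ≠ 0 ∨ b ≠ 0) →
      L (g * Chebyshev.T ℝ (s + k * (2 * b - N))) = 0 := by
    intro b hb hsb
    have hb : (b : ℤ) + 1 ≤ N := by exact_mod_cast mem_range.1 hb
    refine sievedFunctional_sievedPoly_mul_T_eq_zero hlam hk hs (abs_lt.2 ⟨?_, ?_⟩)
    · rcases hsb with h | h
      · have : (0 : ℤ) < s := by exact_mod_cast Nat.pos_of_ne_zero h
        nlinarith
      · have : (0 : ℤ) < b := by exact_mod_cast Nat.pos_of_ne_zero h
        nlinarith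
    · nlinarith
  have hN : (s + k * (2 * N - N) : ℤ) = k * N + s := by ring
  rw [sum_range_succ, hN, htop] at hsum
  rcases eq_or_ne s 0 with rfl | h0
  · obtain ⟨M, rfl⟩ := Nat.exists_eq_succ_of_ne_zero (n := N) (by rintro rfl; simp at hn)
    have hM : ((0 : ℕ) + k * (2 * (0 : ℕ) - (M + 1 : ℕ)) : ℤ) = -(k * (M + 1 : ℕ) + (0 : ℕ)) := by
      push_cast; ring
    rw [Nat.succ_eq_add_one] at *
    rw [sum_range_succ', sum_eq_zero (fun b hb => by
      rw [hzero (b + 1) (by simpa using hb) (by simp), mul_zero]), hM,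
      Polynomial.Chebyshev.T_neg] at hsum
    have h1 := mul_risingBinom_add_one lam (M + 1)
    rw [sievedWeight, if_pos rfl, hsum]
    simp only [jacobiCoeff, Nat.sub_zero, Nat.sub_self, risingBinom_zero, mul_one, one_mul]
      at htop ⊢
    have hb : risingBinom lam (M + 1) =
        lam / (lam + (M + 1 : ℕ)) * risingBinom (lam + 1) (M + 1) := by
      field_simp
      linarith
    rw [hb, zero_add, mul_assoc (lam / _), htop]
    push_cast
    field_simp
    ring
  · rw [sum_eq_zero (fun b hb => by rw [hzero b hb (Or.inl h0), mul_zero])] at hsum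
    rw [hsum, sievedWeight, if_neg h0]
    ring

end Sieved

section OrthogonalPolynomials

variable {lam : ℝ} {k : ℕ}

lemma sievedFunctional_one (hlam : 0 < lam) (k : ℕ) :
    sievedFunctional hlam k 1 = sievedMoment lam k 0 := by
  simpa using sievedFunctional_T hlam k 0

lemma hnorm_wminus (hlam : 0 < lam) (k : ℕ) (f : ℝ[X]) :
    hnorm (wminus lam k) f = sievedFunctional hlam k (f * f) / sievedMoment lam k 0 := by
  rw [← sievedFunctional_one hlam, sievedFunctional_apply, sievedFunctional_apply]
  simp [hnorm, sq]

lemma exists_sievedPoly_eq_smul (hlam : 0 < lam) (hk : k ≠ 0) {q : ℕ → ℝ[X]}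
    (hq : IsOPS (wminus lam k) q) {N s : ℕ} (hs : s < k) :
    ∃ c : ℝ, sievedPoly lam k N s = c • q (k * N + s) := by
  obtain ⟨c, hc⟩ := exists_degree_sub_smul_lt (hq.1 (k * N + s)) (degree_sievedPoly_le lam k N s)
  refine ⟨c, sub_eq_zero.1 ?_⟩
  set f := sievedPoly lam k N s - c • q (k * N + s) with hf
  have h1 : sievedFunctional hlam k (sievedPoly lam k N s * f) = 0 := by
    refine linearMap_eq_zero_of_degree_lt (p := fun n => Chebyshev.T ℝ n)
      (by simp) (sievedFunctional hlam k ∘ₗ LinearMap.mulLeft ℝ (sievedPoly lam k N s))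
      (fun m hm => ?_) hc
    refine sievedFunctional_sievedPoly_mul_T_eq_zero hlam hk hs ?_
    rw [Nat.abs_cast]
    exact_mod_cast hm
  have h2 : sievedFunctional hlam k (q (k * N + s) * f) = 0 := by
    refine linearMap_eq_zero_of_degree_lt hq.1
      (sievedFunctional hlam k ∘ₗ LinearMap.mulLeft ℝ (q (k * N + s))) (fun m hm => ?_) hc
    rw [LinearMap.comp_apply, LinearMap.mulLeft_apply, sievedFunctional_apply]
    simpa only [eval_mul] using hq.2 _ _ hm.ne'
  by_contra hne
  refine (sievedFunctional_mul_self_pos hlam hk hne).ne' ?_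
  nth_rw 1 [hf]
  rw [sub_mul, map_sub, h1, smul_mul_assoc, map_smul, h2, smul_zero, sub_zero]

lemma eval_mul_eval_div_hnorm (hlam : 0 < lam) (hk : k ≠ 0) {q : ℕ → ℝ[X]}
    (hq : IsOPS (wminus lam k) q) {N s : ℕ} (hs : s < k) (x y : ℝ) :
    (q (k * N + s)).eval x * (q (k * N + s)).eval y / hnorm (wminus lam k) (q (k * N + s)) =
      sievedWeight lam N s * (sievedPoly lam k N s).eval x * (sievedPoly lam k N s).eval y /
        sievedValue lam N := by
  obtain ⟨c, hc⟩ := exists_sievedPoly_eq_smul hlam hk hq (N := N) hs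
  have hV := sievedValue_pos hlam N
  have hc0 : c ≠ 0 := by
    rintro rfl
    rw [← eval_one_sievedPoly lam k N s, hc] at hV
    simp at hV
  have hq0 : q (k * N + s) ≠ 0 :=
    degree_ne_bot.1 (by rw [hq.1]; exact WithBot.natCast_ne_bot _)
  have hqq := (sievedFunctional_mul_self_pos hlam hk hq0).ne'
  have hM : sievedMoment lam k 0 ≠ 0 := by
    simpa [sievedFunctional_one] using (sievedFunctional_mul_self_pos hlam hk one_ne_zero).ne'
  have hn := sievedFunctional_sievedPoly_mul_self hlam hk (N := N) hs
  rw [hnorm_wminus hlam, hc]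
  rw [hc, smul_mul_smul_comm, map_smul, smul_eq_mul] at hn
  rw [eval_smul, eval_smul, smul_eq_mul, smul_eq_mul, div_div_eq_mul_div,
    div_eq_div_iff hqq hV.ne']
  linear_combination (-(q (k * N + s)).eval x * (q (k * N + s)).eval y) * hn

end OrthogonalPolynomials

section GeneratingFunction

open ComplexConjugate

lemma hasSum_risingBinom_mul_pow (x : ℝ) {w : ℂ} (hw : ‖w‖ < 1) :
    HasSum (fun n => (risingBinom x n : ℂ) * w ^ n) ((1 - w) ^ (-x : ℂ)) := by
  have h := (Complex.one_div_one_sub_cpow_hasFPowerSeriesOnBall_zero x).hasSum (y := w)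
    (by simpa [← ofReal_norm] using hw)
  rw [zero_add, one_div, ← Complex.cpow_neg] at h
  refine h.congr_fun fun n => ?_
  rw [risingBinom_eq_choose, Complex.ofReal_choose]
  simp [mul_comm]

lemma hasSum_sum_risingBinom_mul (x y : ℝ) {w v : ℂ} (hw : ‖w‖ < 1) (hv : ‖v‖ < 1) :
    HasSum (fun N => ∑ a ∈ range (N + 1),
        (risingBinom x a * risingBinom y (N - a) : ℝ) * (w ^ a * v ^ (N - a)))
      ((1 - w) ^ (-x : ℂ) * (1 - v) ^ (-y : ℂ)) := by
  have h1 := hasSum_risingBinom_mul_pow x hw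
  have h2 := hasSum_risingBinom_mul_pow y hv
  have h := hasSum_sum_range_mul_of_summable_norm h1.summable.norm h2.summable.norm
  rw [h1.tsum_eq, h2.tsum_eq] at h
  refine h.congr_fun fun N => sum_congr rfl fun a _ => ?_
  push_cast
  ring

lemma hasSum_div_mul_mod {a : ℕ → ℂ} {A : ℂ} (ha : HasSum a A) (b : ℕ → ℂ) {k : ℕ} (hk : k ≠ 0) :
    HasSum (fun n => a (n / k) * b (n % k)) (A * ∑ s ∈ range k, b s) := by
  have : NeZero k := ⟨hk⟩
  have hb : HasSum (fun s : Fin k => b s) (∑ s ∈ range k, b s) := by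
    rw [← Fin.sum_univ_eq_sum_range]
    exact hasSum_fintype _
  have h := HasSum.mul (f := a) (g := fun s : Fin k => b s) ha hb
    (summable_mul_of_summable_norm (f := a) (g := fun s : Fin k => b s) ha.summable.norm
      hb.summable.norm)
  exact (Nat.divModEquiv k).hasSum_iff.2 h

lemma one_sub_cpow_neg_mul_conj (x : ℝ) {w : ℂ} (hw : ‖w‖ < 1) :
    (1 - w) ^ (-x : ℂ) * (1 - conj w) ^ (-x : ℂ) = ((Complex.normSq (1 - w) ^ x)⁻¹ : ℝ) := by
  have hre : 0 < (1 - w).re := by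
    have := (Complex.abs_re_le_norm w).trans_lt hw
    simpa using (abs_lt.1 this).2
  have harg : (1 - w).arg ≠ π := fun h => by
    have := (Complex.arg_eq_pi_iff.1 h).1
    linarith
  have hconj : (1 - conj w) ^ (-x : ℂ) = conj ((1 - w) ^ (-x : ℂ)) := by
    have := Complex.conj_cpow (1 - w) (-x : ℂ) harg
    simpa only [map_sub, map_one, map_neg, Complex.conj_ofReal] using this
  rw [hconj, Complex.mul_conj, Complex.normSq_eq_norm_sq, Complex.normSq_eq_norm_sq,
    ← Complex.ofReal_neg, Complex.norm_cpow_real, ← rpow_neg (by positivity),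
    ← rpow_natCast_mul (norm_nonneg _), ← rpow_mul_natCast (norm_nonneg _)]
  congr 2
  push_cast
  ring

lemma sievedWeight_mul_sum_jacobiCoeff {lam : ℝ} (hlam : 0 < lam) (N : ℕ) {c : ℕ → ℝ}
    (hc : ∀ a ≤ N, c (N - a) = c a) :
    sievedWeight lam N 0 * ∑ a ∈ range (N + 1), jacobiCoeff lam N a * c a =
      2 * ∑ a ∈ range (N + 1), jacobiCoeff lam N a * c a -
        ∑ a ∈ range (N + 1), risingBinom lam a * risingBinom lam (N - a) * c a := by
  have h1 : lam * ∑ a ∈ range (N + 1), jacobiCoeff lam N a * c a =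
      ∑ a ∈ range (N + 1), (lam + a) * (risingBinom lam a * risingBinom lam (N - a) * c a) := by
    rw [mul_sum]
    refine sum_congr rfl fun a _ => ?_
    rw [jacobiCoeff]
    linear_combination (risingBinom lam (N - a) * c a) * mul_risingBinom_add_one lam a
  have h2 : lam * ∑ a ∈ range (N + 1), jacobiCoeff lam N a * c a =
      ∑ a ∈ range (N + 1), (lam + (N - a)) *
        (risingBinom lam a * risingBinom lam (N - a) * c a) := by
    rw [h1, ← sum_range_reflect]
    refine sum_congr rfl fun a ha => ?_
    have ha : a ≤ N := Nat.lt_succ_iff.1 (mem_range.1 ha)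
    rw [show N + 1 - 1 - a = N - a by omega, hc a ha, Nat.sub_sub_self ha, Nat.cast_sub ha]
    ring
  have h3 : 2 * lam * ∑ a ∈ range (N + 1), jacobiCoeff lam N a * c a =
      (2 * lam + N) * ∑ a ∈ range (N + 1), risingBinom lam a * risingBinom lam (N - a) * c a := by
    rw [two_mul, add_mul, h2]
    nth_rw 1 [← h2]
    rw [h1, ← sum_add_distrib, mul_sum]
    refine sum_congr rfl fun a _ => ?_
    ring
  have hpos : 2 * lam + N ≠ 0 := by positivity
  rw [sievedWeight, if_pos rfl]
  field_simp
  linarith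

lemma normSq_one_sub_mul_exp (ρ α : ℝ) :
    Complex.normSq (1 - ρ * Complex.exp (α * Complex.I)) = 1 - 2 * ρ * cos α + ρ ^ 2 := by
  rw [Complex.exp_mul_I, ← Complex.ofReal_cos, ← Complex.ofReal_sin, Complex.normSq_apply]
  simp [-Complex.ofReal_cos, -Complex.ofReal_sin]
  linear_combination ρ ^ 2 * sin_sq_add_cos_sq α

lemma re_pow_mul_conj_pow (r θ : ℝ) {k N a : ℕ} (s : ℕ) (ha : a ≤ N) {ζ : ℂ}
    (hζ : ζ = r * Complex.exp (θ * Complex.I)) :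
    ((ζ ^ k) ^ a * conj (ζ ^ k) ^ (N - a) * ζ ^ s).re =
      r ^ (k * N + s) * cos ((s + k * (2 * a - N)) * θ) := by
  obtain ⟨b, rfl⟩ := Nat.exists_eq_add_of_le ha
  have h : (ζ ^ k) ^ a * conj (ζ ^ k) ^ (a + b - a) * ζ ^ s =
      (r ^ (k * (a + b) + s) : ℝ) *
        Complex.exp (((s + k * (2 * a - (a + b : ℕ))) * θ : ℝ) * Complex.I) := by
    have he : Complex.exp (((s + k * (2 * a - (a + b : ℕ))) * θ : ℝ) * Complex.I) =
        Complex.exp (θ * Complex.I) ^ (s + k * a) * Complex.exp (-(θ * Complex.I)) ^ (k * b) := by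
      rw [← Complex.exp_nat_mul, ← Complex.exp_nat_mul, ← Complex.exp_add]
      congr 1
      push_cast
      ring
    have hconj : conj ζ = r * Complex.exp (-(θ * Complex.I)) := by
      rw [hζ, map_mul, Complex.conj_ofReal, ← Complex.exp_conj, map_mul, Complex.conj_ofReal,
        Complex.conj_I, mul_neg]
    rw [he, map_pow, hconj, hζ, Nat.add_sub_cancel_left]
    push_cast
    ring
  rw [h, Complex.re_ofReal_mul, Complex.exp_ofReal_mul_I_re]

lemma hasSum_sievedPoly {lam : ℝ} (hlam : 0 < lam) {k : ℕ} (hk : k ≠ 0) (θ : ℝ) {r : ℝ}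
    (hr0 : 0 ≤ r) (hr1 : r < 1) :
    HasSum (fun n => sievedWeight lam (n / k) (n % k) *
        (sievedPoly lam k (n / k) (n % k)).eval (cos θ) * r ^ n)
      ((1 - r ^ 2) / (1 - 2 * r * cos θ + r ^ 2) /
        (1 - 2 * r ^ k * cos (k * θ) + r ^ (2 * k)) ^ lam) := by
  obtain ⟨ζ, hζ⟩ : ∃ ζ : ℂ, ζ = r * Complex.exp (θ * Complex.I) := ⟨_, rfl⟩
  have hζ1 : ‖ζ‖ < 1 := by
    rwa [hζ, norm_mul, Complex.norm_exp_ofReal_mul_I, mul_one, Complex.norm_real,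
      norm_of_nonneg hr0]
  have hw : ‖ζ ^ k‖ < 1 := by
    rw [norm_pow]
    exact pow_lt_one₀ (norm_nonneg _) hζ1 hk
  have hw' : ‖conj (ζ ^ k)‖ < 1 := by rwa [Complex.norm_conj]
  have h1 := hasSum_div_mul_mod (hasSum_sum_risingBinom_mul (lam + 1) lam hw hw') (ζ ^ ·) hk
  have h2 := hasSum_div_mul_mod (hasSum_sum_risingBinom_mul lam lam hw hw')
    (fun s => if s = 0 then 1 else 0) hk
  have h := Complex.hasSum_re ((h1.mul_left 2).sub h2)
  convert h using 1
  · funext n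
    obtain ⟨N, s, hN, hs, hn⟩ : ∃ N s, n / k = N ∧ n % k = s ∧ n = k * N + s :=
      ⟨_, _, rfl, rfl, (Nat.div_add_mod n k).symm⟩
    have hre : ∀ (f : ℕ → ℝ) (s : ℕ), ((∑ a ∈ range (N + 1),
        (f a : ℂ) * ((ζ ^ k) ^ a * conj (ζ ^ k) ^ (N - a))) * ζ ^ s).re =
        (∑ a ∈ range (N + 1), f a * cos ((s + k * (2 * a - N)) * θ)) * r ^ (k * N + s) := by
      intro f s
      rw [sum_mul, Complex.re_sum, sum_mul]
      refine sum_congr rfl fun a ha => ?_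
      rw [mul_assoc, Complex.re_ofReal_mul,
        re_pow_mul_conj_pow r θ s (Nat.lt_succ_iff.1 (mem_range.1 ha)) hζ]
      ring
    have hre2 := hre (jacobiCoeff lam N) s
    simp only [jacobiCoeff] at hre2
    rw [hN, hs, hn, eval_cos_sievedPoly, Complex.sub_re, ← Complex.ofReal_ofNat,
      Complex.re_ofReal_mul, hre2]
    rcases eq_or_ne s 0 with rfl | h0
    · have hre3 := hre (fun a => risingBinom lam a * risingBinom lam (N - a)) 0
      rw [pow_zero, mul_one] at hre3
      rw [if_pos rfl, mul_one, hre3, sievedWeight_mul_sum_jacobiCoeff hlam]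
      · simp only [jacobiCoeff]
        ring
      · intro a ha
        rw [← cos_neg, Nat.cast_sub ha]
        congr 1
        push_cast
        ring
    · rw [if_neg h0, mul_zero, Complex.zero_re, sievedWeight, if_neg h0]
      simp only [jacobiCoeff]
      ring
  · have hne : ∀ z : ℂ, ‖z‖ < 1 → 1 - z ≠ 0 := fun z hz h => by
      rw [← sub_eq_zero.1 h] at hz
      simp at hz
    have hgeom : ∑ s ∈ range k, ζ ^ s = (1 - ζ ^ k) / (1 - ζ) := by
      rw [geom_sum_eq (fun h => hne ζ hζ1 (by rw [h, sub_self])), ← neg_div_neg_eq, neg_sub,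
        neg_sub]
    have hpow : (1 - ζ ^ k) ^ (-(lam + 1 : ℝ) : ℂ) * (1 - ζ ^ k) = (1 - ζ ^ k) ^ (-lam : ℂ) := by
      nth_rw 2 [← Complex.cpow_one (1 - ζ ^ k)]
      rw [← Complex.cpow_add _ _ (hne _ hw)]
      congr 1
      push_cast
      ring
    have hval : 2 * ((1 - ζ ^ k) ^ (-(lam + 1 : ℝ) : ℂ) * (1 - conj (ζ ^ k)) ^ (-lam : ℂ) *
          ∑ s ∈ range k, ζ ^ s) - (1 - ζ ^ k) ^ (-lam : ℂ) * (1 - conj (ζ ^ k)) ^ (-lam : ℂ) *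
          ∑ s ∈ range k, (if s = 0 then 1 else 0) =
        ((Complex.normSq (1 - ζ ^ k) ^ lam)⁻¹ : ℝ) * ((2 : ℝ) * (1 - ζ)⁻¹ - 1) := by
      rw [← one_sub_cpow_neg_mul_conj lam hw, hgeom, ← hpow, sum_ite_eq' (range k) 0,
        if_pos (by simpa using Nat.pos_of_ne_zero hk)]
      push_cast
      ring
    have hnw : Complex.normSq (1 - ζ ^ k) = 1 - 2 * r ^ k * cos (k * θ) + r ^ (2 * k) := by
      rw [pow_mul', ← normSq_one_sub_mul_exp, hζ, mul_pow, ← Complex.exp_nat_mul]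
      push_cast
      ring_nf
    have hnζ : Complex.normSq (1 - ζ) = 1 - 2 * r * cos θ + r ^ 2 := by
      rw [hζ, normSq_one_sub_mul_exp]
    have hreζ : (1 - ζ).re = 1 - r * cos θ := by
      rw [hζ, Complex.sub_re, Complex.re_ofReal_mul, Complex.exp_ofReal_mul_I_re, Complex.one_re]
    have hpos := Complex.normSq_pos.2 (hne ζ hζ1)
    rw [hval, Complex.re_ofReal_mul, Complex.sub_re, Complex.re_ofReal_mul, Complex.inv_re, hreζ,
      hnw, Complex.one_re]
    rw [hnζ] at hpos ⊢
    have hpos' := hpos.ne'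
    rw [div_eq_mul_inv _ (_ ^ lam), mul_comm]
    congr 1
    rw [div_eq_iff hpos', sub_mul, mul_assoc, div_mul_cancel₀ _ hpos']
    ring

end GeneratingFunction

lemma eval_cos_sievedPoly_pi {k N s : ℕ} (hk : k ≠ 0) (lam : ℝ) (p : ℕ) (θ : ℝ) :
    (sievedPoly lam k N s).eval (cos θ) * (sievedPoly lam k N s).eval (cos (p * π / k)) =
      ((sievedPoly lam k N s).eval (cos (θ + p * π / k)) +
        (sievedPoly lam k N s).eval (cos (θ - p * π / k))) / 2 * sievedValue lam N := by
  have hk' : (k : ℝ) ≠ 0 := by exact_mod_cast hk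
  have hcos : ∀ a : ℕ, cos ((s + k * (2 * a - N)) * (p * π / k)) =
      cos ((k * N + s) * (p * π / k)) := by
    intro a
    rw [← cos_add_int_mul_two_pi _ (p * (N - a))]
    congr 1
    push_cast
    field_simp
    ring
  simp only [eval_cos_sievedPoly, hcos, ← sum_mul, ← sum_add_distrib, sievedValue]
  rw [mul_left_comm, mul_comm, sum_mul, sum_div]
  congr 1
  refine sum_congr rfl fun a _ => ?_
  rw [← hcos a, mul_add _ θ, mul_sub _ θ, cos_add, cos_sub]
  ring

/-- Poisson kernel of the sieved Gegenbauer polynomials of the first kind,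
evaluated at `cos(pπ/k)`. -/
theorem poisson_sieved_gegenbauer_first (lam : ℝ) (hlam : 0 < lam) (k : ℕ) (hk : 1 ≤ k)
    (p : ℕ) (hp : p ≤ k - 1) (q : ℕ → Polynomial ℝ) (hq : IsOPS (wminus lam k) q)
    (t : ℝ) (ht : t ∈ Set.Icc (-1 : ℝ) 1) (r : ℝ) (hr0 : 0 ≤ r) (hr1 : r < 1) :
    HasSum (fun n : ℕ =>
      (q n).eval t * (q n).eval (Real.cos (p * π / k)) / hnorm (wminus lam k) (q n) * r ^ n)
      ((1 - r ^ 2) * (1 - 2 * r * Real.cos (p * π / k) * t + r ^ 2) /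
        (((1 - 2 * r * Real.cos (p * π / k) * t + r ^ 2) ^ 2 -
            4 * r ^ 2 * Real.sin (p * π / k) ^ 2 * (1 - t ^ 2)) *
          (1 - 2 * (-1 : ℝ) ^ p * r ^ k * chebT k t + r ^ (2 * k)) ^ lam)) := by
  have hk0 : k ≠ 0 := by omega
  set φ : ℝ := p * π / k with hφ
  obtain ⟨θ, rfl⟩ : ∃ θ, cos θ = t := ⟨arccos t, cos_arccos ht.1 ht.2⟩
  have hD₁ : cos (k * (θ + φ)) = (-1) ^ p * chebT k (cos θ) := by
    rw [chebT, Polynomial.Chebyshev.T_real_cos, Int.cast_natCast, ← cos_add_nat_mul_pi]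
    congr 1
    rw [hφ]
    field_simp
  have hD₂ : cos (k * (θ - φ)) = (-1) ^ p * chebT k (cos θ) := by
    rw [chebT, Polynomial.Chebyshev.T_real_cos, Int.cast_natCast, ← cos_sub_nat_mul_pi]
    congr 1
    rw [hφ]
    field_simp
  have hpos : ∀ α : ℝ, 0 < 1 - 2 * r * cos α + r ^ 2 := by
    intro α
    nlinarith [cos_le_one α, sq_pos_of_pos (sub_pos.2 hr1),
      mul_nonneg hr0 (sub_nonneg.2 (cos_le_one α))]
  have h : HasSum (α := ℝ) (β := ℕ) _ _ := ((hasSum_sievedPoly hlam hk0 (θ + φ) hr0 hr1).add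
    (hasSum_sievedPoly hlam hk0 (θ - φ) hr0 hr1)).mul_left (1 / 2)
  convert h using 1
  · funext n
    have hn := eval_mul_eval_div_hnorm hlam hk0 hq (N := n / k)
      (Nat.mod_lt n (Nat.pos_of_ne_zero hk0)) (cos θ) (cos φ)
    rw [Nat.div_add_mod] at hn
    rw [hn, mul_assoc, eval_cos_sievedPoly_pi hk0, mul_div_assoc,
      mul_div_cancel_right₀ _ (sievedValue_pos hlam _).ne']
    ring
  · have h₁ := (hpos (θ + φ)).ne'
    have h₂ := (hpos (θ - φ)).ne'
    have hden : (1 - 2 * r * cos φ * cos θ + r ^ 2) ^ 2 -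
        4 * r ^ 2 * sin φ ^ 2 * (1 - cos θ ^ 2) =
        (1 - 2 * r * cos (θ + φ) + r ^ 2) * (1 - 2 * r * cos (θ - φ) + r ^ 2) := by
      rw [cos_add, cos_sub, ← sin_sq θ]
      ring
    have hnum : 1 - 2 * r * cos φ * cos θ + r ^ 2 =
        ((1 - 2 * r * cos (θ + φ) + r ^ 2) + (1 - 2 * r * cos (θ - φ) + r ^ 2)) / 2 := by
      rw [cos_add, cos_sub]
      ring
    have hD : 1 - 2 * (-1) ^ p * r ^ k * chebT k (cos θ) + r ^ (2 * k) =
        1 - 2 * r ^ k * ((-1) ^ p * chebT k (cos θ)) + r ^ (2 * k) := by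
      ring
    rw [hden, hnum, hD, hD₁, hD₂, ← add_div, div_add_div _ _ h₁ h₂, ← mul_div_assoc, ← div_div]
    field_simp
    ring
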